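/- arXiv:1303.3603 — 4 statements merged into one kernel-verified Lean document; each statement's English description precedes it below -/
import Mathlib

section
/- Let c∞, c0 be complex numbers with c∞ ≠ 0, c0 ≠ 0, c∞² − c0² ≠ 0 and c∞² + c0² ≠ 0. Then the cubic polynomial C(t) = −256t³ + 192c∞c0·t² + (6c∞²c0² − 27c∞⁴ − 27c0⁴)·t + 4c∞³c0³ has exactly three complex roots, these three roots are pairwise distinct, and none of them is zero. (Consequently, under these genericity assumptions the third Painlevé equation (P_{III'})_{D6} has exactly three turning points in ℂ×, all of them simple.) -/
/-- Under the genericity assumptions `c∞, c0, c∞² − c0², c∞² + c0² ≠ 0`, the cubic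
`C(t) = −256t³ + 192c∞c0·t² + (6c∞²c0² − 27c∞⁴ − 27c0⁴)·t + 4c∞³c0³` has exactly three
pairwise distinct complex roots, none of which is zero; i.e. `(P_III')_{D6}` has exactly
three turning points in `ℂ×`, all simple. -/
theorem three_simple_turning_points (cinf c0 : ℂ)
    (h1 : cinf ≠ 0) (h2 : c0 ≠ 0) (h3 : cinf ^ 2 - c0 ^ 2 ≠ 0) (h4 : cinf ^ 2 + c0 ^ 2 ≠ 0) :
    ∃ t1 t2 t3 : ℂ,
      t1 ≠ t2 ∧ t1 ≠ t3 ∧ t2 ≠ t3 ∧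
      t1 ≠ 0 ∧ t2 ≠ 0 ∧ t3 ≠ 0 ∧
      (∀ t : ℂ,
        -256 * t ^ 3 + 192 * cinf * c0 * t ^ 2
            + (6 * cinf ^ 2 * c0 ^ 2 - 27 * cinf ^ 4 - 27 * c0 ^ 4) * t
            + 4 * cinf ^ 3 * c0 ^ 3 = 0 ↔ (t = t1 ∨ t = t2 ∨ t = t3)) := by
  let P : Cubic ℂ := ⟨-256, 192 * cinf * c0,
    6 * cinf ^ 2 * c0 ^ 2 - 27 * cinf ^ 4 - 27 * c0 ^ 4, 4 * cinf ^ 3 * c0 ^ 3⟩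
  have ha : P.a ≠ 0 := by norm_num [P]
  obtain ⟨x, y, z, hroots⟩ := (Cubic.splits_iff_roots_eq_three (φ := RingHom.id ℂ) ha).1
    (IsAlgClosed.splits _)
  have hdiscr : P.discr = -20155392 * (cinf ^ 2 - c0 ^ 2) ^ 4 * (cinf ^ 2 + c0 ^ 2) ^ 2 := by
    simp only [Cubic.discr, P]
    ring
  have hdiscr_ne : P.discr ≠ 0 := by
    rw [hdiscr]
    exact mul_ne_zero (mul_ne_zero (by norm_num) (pow_ne_zero 4 h3)) (pow_ne_zero 2 h4)
  obtain ⟨hxy, hxz, hyz⟩ := (Cubic.discr_ne_zero_iff_roots_ne ha hroots).1 hdiscr_ne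
  have hiff (t : ℂ) : -256 * t ^ 3 + 192 * cinf * c0 * t ^ 2
      + (6 * cinf ^ 2 * c0 ^ 2 - 27 * cinf ^ 4 - 27 * c0 ^ 4) * t
      + 4 * cinf ^ 3 * c0 ^ 3 = 0 ↔ (t = x ∨ t = y ∨ t = z) := by
    have hmem := Cubic.mem_roots_iff (P := P) (Cubic.ne_zero_of_a_ne_zero ha) t
    rw [show P.roots = {x, y, z} from hroots] at hmem
    simpa [P] using hmem.symm
  have hne {t : ℂ} (ht : t = x ∨ t = y ∨ t = z) : t ≠ 0 := by
    rintro rfl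
    simpa [h1, h2] using (hiff 0).2 ht
  exact ⟨x, y, z, hxy, hxz, hyz, hne (by simp), hne (by simp), hne (by simp), hiff⟩
end

section
/- (Bäcklund transformation T₁ for the Hamiltonian form of (P_{III'})_{D6}.) Let η, c∞, c0 ∈ ℂ with η ≠ 0, let U ⊆ ℂ be open with 0 ∉ U, and let λ, μ : U → ℂ be complex-differentiable functions satisfying, for all t ∈ U: t·λ′(t) = η·(2λ²μ − λ² − (c0 − η⁻¹)λ + t) and t·μ′(t) = −η·(2λμ² − (2λ + c0 − η⁻¹)μ + (c∞ + c0 − η⁻¹)/2). Assume moreover λ(t) ≠ 0 and D(t) := 2λ(t)²(μ(t) − 1) + (c∞ − c0 + η⁻¹)λ(t) + 2t ≠ 0 for all t ∈ U. Define Λ(t) = −t/λ(t) + (c∞ + c0 + η⁻¹)·t/D(t) and M(t) = λ(t)²(μ(t) − 1)/t + (c∞ − c0 + η⁻¹)λ(t)/(2t) + 1. Then for all t ∈ U: t·Λ′(t) = η·(2Λ²M − Λ² − c0·Λ + t) and t·M′(t) = −η·(2ΛM² − (2Λ + c0)M + (c∞ + c0 + η⁻¹)/2). -/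
/-- The pointwise algebraic identities behind the transformation `T₁`: `dl`, `dm`, `dD` are the
derivatives of `l`, `m` and of the denominator `D`, and `k = η⁻¹`. -/
lemma backlund_T1_identities {η k cinf c0 t l m dl dm D dD : ℂ} (hηk : η * k = 1)
    (h_t : t ≠ 0) (hl₀ : l ≠ 0) (hD₀ : D ≠ 0)
    (hdl : t * dl = η * (2 * l ^ 2 * m - l ^ 2 - (c0 - k) * l + t))
    (hdm : t * dm = -η * (2 * l * m ^ 2 - (2 * l + c0 - k) * m + (cinf + c0 - k) / 2))
    (hD : D = 2 * l ^ 2 * (m - 1) + (cinf - c0 + k) * l + 2 * t)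
    (hdD : dD = 4 * l * dl * (m - 1) + 2 * l ^ 2 * dm + (cinf - c0 + k) * dl + 2) :
    t * ((-1 * l - -t * dl) / l ^ 2 +
        ((cinf + c0 + k) * 1 * D - (cinf + c0 + k) * t * dD) / D ^ 2) =
      η * (2 * (-t / l + (cinf + c0 + k) * t / D) ^ 2 * (D / (2 * t)) -
        (-t / l + (cinf + c0 + k) * t / D) ^ 2 - c0 * (-t / l + (cinf + c0 + k) * t / D) + t) ∧
    t * ((dD * (2 * t) - D * (2 * 1)) / (2 * t) ^ 2) =
      -η * (2 * (-t / l + (cinf + c0 + k) * t / D) * (D / (2 * t)) ^ 2 -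
        (2 * (-t / l + (cinf + c0 + k) * t / D) + c0) * (D / (2 * t)) + (cinf + c0 + k) / 2) := by
  have hk₀ : k ≠ 0 := right_ne_zero_of_mul_eq_one hηk
  obtain rfl : η = 1 / k := eq_one_div_of_mul_eq_one_left hηk
  obtain rfl : m = 1 + (D - (cinf - c0 + k) * l - 2 * t) / (2 * l ^ 2) := by
    rw [hD]
    field_simp
    ring
  rw [mul_comm, ← eq_div_iff h_t] at hdl hdm
  clear hD hηk
  subst hdD hdl hdm
  constructor
  · field_simp
    ring
  · field_simp
    ring

/-- Bäcklund transformation `T₁` for the Hamiltonian form `(H_III')_{D6}` of the third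
Painlevé equation: if `(λ, μ)` solves the Hamiltonian system with parameters `(c∞, c0)`,
then `(Λ, M)` solves the Hamiltonian system with parameters `(c∞ + η⁻¹, c0 + η⁻¹)`. -/
theorem backlund_T1 (η cinf c0 : ℂ) (hη : η ≠ 0)
    (U : Set ℂ) (hU : IsOpen U) (hU0 : (0 : ℂ) ∉ U)
    (lam mu : ℂ → ℂ)
    (hlamDiff : ∀ t ∈ U, DifferentiableAt ℂ lam t)
    (hmuDiff : ∀ t ∈ U, DifferentiableAt ℂ mu t)
    (hlam : ∀ t ∈ U, t * deriv lam t =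
      η * (2 * (lam t) ^ 2 * mu t - (lam t) ^ 2 - (c0 - η⁻¹) * lam t + t))
    (hmu : ∀ t ∈ U, t * deriv mu t =
      -η * (2 * lam t * (mu t) ^ 2 - (2 * lam t + c0 - η⁻¹) * mu t + (cinf + c0 - η⁻¹) / 2))
    (hlam0 : ∀ t ∈ U, lam t ≠ 0)
    (hD : ∀ t ∈ U,
      2 * (lam t) ^ 2 * (mu t - 1) + (cinf - c0 + η⁻¹) * lam t + 2 * t ≠ 0)
    (Λ M : ℂ → ℂ)
    (hΛ : Λ = fun t => -t / lam t +
      (cinf + c0 + η⁻¹) * t /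
        (2 * (lam t) ^ 2 * (mu t - 1) + (cinf - c0 + η⁻¹) * lam t + 2 * t))
    (hM : M = fun t =>
      (lam t) ^ 2 * (mu t - 1) / t + (cinf - c0 + η⁻¹) * lam t / (2 * t) + 1) :
    ∀ t ∈ U,
      t * deriv Λ t = η * (2 * (Λ t) ^ 2 * M t - (Λ t) ^ 2 - c0 * Λ t + t) ∧
      t * deriv M t =
        -η * (2 * Λ t * (M t) ^ 2 - (2 * Λ t + c0) * M t + (cinf + c0 + η⁻¹) / 2) := by
  intro t ht
  have h_t : t ≠ 0 := fun h => hU0 (h ▸ ht)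
  have hl := (hlamDiff t ht).hasDerivAt
  have hm := (hmuDiff t ht).hasDerivAt
  have hD₀ := hD t ht
  have hdD : HasDerivAt (fun s => 2 * (lam s) ^ 2 * (mu s - 1) +
      (cinf - c0 + η⁻¹) * lam s + 2 * s)
      (4 * lam t * deriv lam t * (mu t - 1) + 2 * lam t ^ 2 * deriv mu t +
        (cinf - c0 + η⁻¹) * deriv lam t + 2) t := by
    refine (((((hl.fun_pow 2).const_mul 2).fun_mul (hm.sub_const 1)).fun_add
      (hl.const_mul (cinf - c0 + η⁻¹))).fun_add ((hasDerivAt_id' t).const_mul 2)).congr_deriv ?_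
    push_cast
    ring
  have hdΛ := (((hasDerivAt_id' t).fun_neg.fun_div hl (hlam0 t ht)).fun_add
    (((hasDerivAt_id' t).const_mul (cinf + c0 + η⁻¹)).fun_div hdD hD₀))
  have hMD : M =ᶠ[nhds t] fun s => (2 * (lam s) ^ 2 * (mu s - 1) +
      (cinf - c0 + η⁻¹) * lam s + 2 * s) / (2 * s) := by
    filter_upwards [hU.mem_nhds ht] with s hs
    have h_s : s ≠ 0 := fun h => hU0 (h ▸ hs)
    rw [hM]
    field_simp
  have hdM := (hdD.fun_div ((hasDerivAt_id' t).const_mul 2)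
    (mul_ne_zero two_ne_zero h_t)).congr_of_eventuallyEq hMD
  rw [hdM.deriv, hMD.eq_of_nhds, hΛ, hdΛ.deriv]
  exact backlund_T1_identities (mul_inv_cancel₀ hη) h_t (hlam0 t ht) hD₀ (hlam t ht) (hmu t ht)
    rfl rfl
end

section
/- (Bäcklund transformation T₂ for the Hamiltonian form of (P_{III'})_{D6}.) Let η, c∞, c0 ∈ ℂ with η ≠ 0, let U ⊆ ℂ be open with 0 ∉ U, and let λ, μ : U → ℂ be complex-differentiable functions satisfying, for all t ∈ U: t·λ′(t) = η·(2λ²μ − λ² − (c0 − η⁻¹)λ + t) and t·μ′(t) = −η·(2λμ² − (2λ + c0 − η⁻¹)μ + (c∞ + c0 − η⁻¹)/2). Assume moreover μ(t) ≠ 1 and E(t) := 2λ(t)(μ(t) − 1) + (c∞ − c0 + η⁻¹) ≠ 0 for all t ∈ U. Define Λ(t) = 2t(μ(t) − 1)/E(t) and M(t) = (1/t)·{ ((c∞ + c0 − η⁻¹)/2)·(λ + (c∞ − c0 + η⁻¹)/(2(μ − 1))) − (λ + (c∞ − c0 + η⁻¹)/(2(μ − 1)))²·μ }. Then for all t ∈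 U: t·Λ′(t) = η·(2Λ²M − Λ² − (c0 − 2η⁻¹)Λ + t) and t·M′(t) = −η·(2ΛM² − (2Λ + c0 − 2η⁻¹)M + (c∞ + c0 − η⁻¹)/2). -/
/-- Bäcklund transformation `T₂` for the Hamiltonian form `(H_III')_{D6}` of the third
Painlevé equation: if `(λ, μ)` solves the Hamiltonian system with parameters `(c∞, c0)`,
then `(Λ, M)` solves the Hamiltonian system with parameters `(c∞ + η⁻¹, c0 − η⁻¹)`. -/
theorem backlund_T2 (η cinf c0 : ℂ) (hη : η ≠ 0)
    (U : Set ℂ) (hU : IsOpen U) (hU0 : (0 : ℂ) ∉ U)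
    (lam mu : ℂ → ℂ)
    (hlamDiff : ∀ t ∈ U, DifferentiableAt ℂ lam t)
    (hmuDiff : ∀ t ∈ U, DifferentiableAt ℂ mu t)
    (hlam : ∀ t ∈ U, t * deriv lam t =
      η * (2 * (lam t) ^ 2 * mu t - (lam t) ^ 2 - (c0 - η⁻¹) * lam t + t))
    (hmu : ∀ t ∈ U, t * deriv mu t =
      -η * (2 * lam t * (mu t) ^ 2 - (2 * lam t + c0 - η⁻¹) * mu t + (cinf + c0 - η⁻¹) / 2))
    (hmu1 : ∀ t ∈ U, mu t ≠ 1)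
    (hE : ∀ t ∈ U, 2 * lam t * (mu t - 1) + (cinf - c0 + η⁻¹) ≠ 0)
    (Λ M : ℂ → ℂ)
    (hΛ : Λ = fun t =>
      2 * t * (mu t - 1) / (2 * lam t * (mu t - 1) + (cinf - c0 + η⁻¹)))
    (hM : M = fun t => (1 / t) *
      (((cinf + c0 - η⁻¹) / 2) * (lam t + (cinf - c0 + η⁻¹) / (2 * (mu t - 1)))
        - (lam t + (cinf - c0 + η⁻¹) / (2 * (mu t - 1))) ^ 2 * mu t)) :
    ∀ t ∈ U,
      t * deriv Λ t =
        η * (2 * (Λ t) ^ 2 * M t - (Λ t) ^ 2 - (c0 - 2 * η⁻¹) * Λ t + t) ∧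
      t * deriv M t =
        -η * (2 * Λ t * (M t) ^ 2 - (2 * Λ t + c0 - 2 * η⁻¹) * M t
          + (cinf + c0 - η⁻¹) / 2) := by
  intro t ht
  have ht0 : t ≠ 0 := fun h => hU0 (h ▸ ht)
  have hu : ∀ s ∈ U, mu s - 1 ≠ 0 := fun s hs => sub_ne_zero.mpr (hmu1 s hs)
  -- In terms of `q = λ + (c∞ - c0 + η⁻¹) / (2 (μ - 1))` one has `Λ = t / q`.
  set q : ℂ → ℂ := fun s => lam s + (cinf - c0 + η⁻¹) / (2 * (mu s - 1)) with hq
  have hEq : ∀ s ∈ U, 2 * lam s * (mu s - 1) + (cinf - c0 + η⁻¹) = 2 * (mu s - 1) * q s := by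
    intro s hs
    have := hu s hs
    simp only [hq]
    field_simp
  have hq0 : q t ≠ 0 := fun h => hE t ht (by rw [hEq t ht, h, mul_zero])
  have hΛq : ∀ s ∈ U, Λ s = s / q s := by
    intro s hs
    have h1 := hu s hs
    have h2 : (2 : ℂ) * (mu s - 1) ≠ 0 := mul_ne_zero two_ne_zero h1
    rw [hΛ]
    simp only
    rw [hEq s hs, ← mul_div_mul_left s (q s) h2]
    ring
  have hl := (hlamDiff t ht).hasDerivAt
  have hm := (hmuDiff t ht).hasDerivAt
  have hqd : HasDerivAt q (deriv lam t
      - (cinf - c0 + η⁻¹) * (2 * deriv mu t) / (2 * (mu t - 1)) ^ 2) t := by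
    have h := hl.add ((hasDerivAt_const t (cinf - c0 + η⁻¹)).div ((hm.sub_const 1).const_mul 2)
      (mul_ne_zero two_ne_zero (hu t ht)))
    refine h.congr_deriv ?_
    ring
  set q' := deriv lam t - (cinf - c0 + η⁻¹) * (2 * deriv mu t) / (2 * (mu t - 1)) ^ 2 with hq'
  have hlq : lam t = q t - (cinf - c0 + η⁻¹) / (2 * (mu t - 1)) := by simp [hq]
  have hut := hu t ht
  have hlt := hlam t ht
  have hmt := hmu t ht
  have key : t * q' = q t - η * ((cinf + c0 - η⁻¹) * q t - 2 * q t ^ 2 * mu t - t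
      - (c0 - 2 * η⁻¹) * q t + q t ^ 2) := by
    have : t * q' = t * deriv lam t
        - (cinf - c0 + η⁻¹) * (2 * (t * deriv mu t)) / (2 * (mu t - 1)) ^ 2 := by
      rw [hq']; ring
    rw [this, hlt, hmt, hlq]
    field_simp
    ring
  rw [hlq] at hmt
  have hΛd : HasDerivAt Λ ((1 * q t - t * q') / q t ^ 2) t :=
    ((hasDerivAt_id t).div hqd hq0).congr_of_eventuallyEq
      (Filter.eventually_of_mem (hU.mem_nhds ht) hΛq)
  have hMd : HasDerivAt M (-(t ^ 2)⁻¹ * ((cinf + c0 - η⁻¹) / 2 * q t - q t ^ 2 * mu t)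
      + t⁻¹ * ((cinf + c0 - η⁻¹) / 2 * q' - (2 * q t * q' * mu t + q t ^ 2 * deriv mu t))) t := by
    have h := (hasDerivAt_inv ht0).mul
      ((hqd.const_mul ((cinf + c0 - η⁻¹) / 2)).sub ((hqd.pow 2).mul hm))
    rw [hM]
    refine (h.congr_deriv ?_).congr_of_eventuallyEq (Filter.Eventually.of_forall fun s => ?_)
    · simp
    · simp [hq]
  have hMt : M t = t⁻¹ * ((cinf + c0 - η⁻¹) / 2 * q t - q t ^ 2 * mu t) := by
    simp [hM, hq]
  rw [hΛd.deriv, hMd.deriv, hΛq t ht, hMt]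
  clear_value q q'
  constructor
  · rw [one_mul, key]
    field_simp
    ring
  · have : t * (-(t ^ 2)⁻¹ * ((cinf + c0 - η⁻¹) / 2 * q t - q t ^ 2 * mu t)
        + t⁻¹ * ((cinf + c0 - η⁻¹) / 2 * q' - (2 * q t * q' * mu t + q t ^ 2 * deriv mu t)))
        = t⁻¹ * (-((cinf + c0 - η⁻¹) / 2 * q t - q t ^ 2 * mu t)
        + ((cinf + c0 - η⁻¹) / 2 * (t * q')
          - (2 * q t * (t * q') * mu t + q t ^ 2 * (t * deriv mu t)))) := by
      field_simp
    rw [this, key, hmt]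
    field_simp
    ring
end

section
/- (Bäcklund transformation for the degenerate third Painlevé equation of type D₇.) Let η, c ∈ ℂ with η ≠ 0, let U ⊆ ℂ be open with 0 ∉ U, and let λ, μ : U → ℂ be complex-differentiable functions satisfying, for all t ∈ U: t·λ′(t) = η·(2λ²μ − (c − η⁻¹)λ + t) and t·μ′(t) = −η·(2λμ² − (c − η⁻¹)μ + 1). Assume λ(t) ≠ 0 for all t ∈ U. Define Λ(t) = −t·μ(t) + c·t/λ(t) − t²/λ(t)² and M(t) = λ(t)/t. Then for all t ∈ U: t·Λ′(t) = η·(2Λ²M − c·Λ + t) and t·M′(t) = −η·(2ΛM² − c·M + 1). -/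
/-- Bäcklund transformation for the Hamiltonian form `(H_III')_{D7}` of the degenerate
third Painlevé equation of type `D₇`: if `(λ, μ)` solves the system with parameter `c`,
then `(Λ, M) = (−tμ + ct/λ − t²/λ², λ/t)` solves the system with parameter shifted. -/
theorem backlund_D7 (η c : ℂ) (hη : η ≠ 0)
    (U : Set ℂ) (hU : IsOpen U) (hU0 : (0 : ℂ) ∉ U)
    (lam mu : ℂ → ℂ)
    (hlamDiff : ∀ t ∈ U, DifferentiableAt ℂ lam t)
    (hmuDiff : ∀ t ∈ U, DifferentiableAt ℂ mu t)
    (hlam : ∀ t ∈ U, t * deriv lam t =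
      η * (2 * (lam t) ^ 2 * mu t - (c - η⁻¹) * lam t + t))
    (hmu : ∀ t ∈ U, t * deriv mu t =
      -η * (2 * lam t * (mu t) ^ 2 - (c - η⁻¹) * mu t + 1))
    (hlam0 : ∀ t ∈ U, lam t ≠ 0)
    (Λ M : ℂ → ℂ)
    (hΛ : Λ = fun t => -t * mu t + c * t / lam t - t ^ 2 / (lam t) ^ 2)
    (hM : M = fun t => lam t / t) :
    ∀ t ∈ U,
      t * deriv Λ t = η * (2 * (Λ t) ^ 2 * M t - c * Λ t + t) ∧
      t * deriv M t = -η * (2 * Λ t * (M t) ^ 2 - c * M t + 1) := by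
  intro t ht
  have ht0 : t ≠ 0 := fun h => hU0 (h ▸ ht)
  have hl0 := hlam0 t ht
  have hl := (hlamDiff t ht).hasDerivAt
  have hm := (hmuDiff t ht).hasDerivAt
  have hlam' : deriv lam t =
      (η * (2 * (lam t) ^ 2 * mu t - c * lam t + t) + lam t) / t := by
    rw [eq_div_iff ht0, mul_comm, hlam t ht]
    field_simp
    ring
  have hmu' : deriv mu t =
      (-η * (2 * lam t * (mu t) ^ 2 - c * mu t + 1) - mu t) / t := by
    rw [eq_div_iff ht0, mul_comm, hmu t ht]
    field_simp
    ring
  have hid := hasDerivAt_id' t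
  have hderivΛ : HasDerivAt Λ
      (-1 * mu t + -t * deriv mu t
        + (c * 1 * lam t - c * t * deriv lam t) / lam t ^ 2
        - (2 * t * lam t ^ 2 - t ^ 2 * (2 * lam t * deriv lam t)) / (lam t ^ 2) ^ 2) t := by
    rw [hΛ]
    refine HasDerivAt.congr_deriv (((hid.neg.mul hm).add ((hid.const_mul c).div hl hl0)).sub
      ((hid.pow 2).div (hl.pow 2) (pow_ne_zero 2 hl0))) ?_
    simp
  have hderivM : HasDerivAt M ((deriv lam t * t - lam t * 1) / t ^ 2) t := by
    rw [hM]
    exact hl.div hid ht0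
  rw [hderivΛ.deriv, hderivM.deriv, hlam', hmu', hΛ, hM]
  constructor <;>
  · field_simp
    ring
end
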